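/- arXiv:1912.09687 — 2 statements merged into one kernel-verified Lean document; each statement's English description precedes it below -/
import Mathlib

section
/- For every integer g ≥ 1, the graded ℚ-algebra Ř_g = S_g/I_g is a finite-dimensional ℚ-vector space of dimension exactly 2^g. -/
open MvPolynomial

/-- The polynomial `P_g = (1 + u_1 + ⋯ + u_g)(1 - u_1 + u_2 - ⋯ + (-1)^g u_g) - 1`,
where `u_{i+1}` is the variable `X i` for `i : Fin g`. -/
noncomputable def Pg (g : ℕ) : MvPolynomial (Fin g) ℚ :=
  (1 + ∑ i : Fin g, X i) *
    (1 + ∑ i : Fin g, (-1 : MvPolynomial (Fin g) ℚ) ^ ((i : ℕ) + 1) * X i) - 1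

/-- The ideal `I_g` generated by the homogeneous components of `P_g` with respect to the
grading in which `u_i = X (i-1)` has degree `i`. -/
noncomputable def tautIdeal (g : ℕ) : Ideal (MvPolynomial (Fin g) ℚ) :=
  Ideal.span (Set.range fun n : ℕ =>
    weightedHomogeneousComponent (fun i : Fin g => (i : ℕ) + 1) n (Pg g))

namespace TautAux

/-- The graded evaluation `u_i ↦ p_i T^i`. -/
noncomputable def phi {R : Type*} [CommRing R] [Algebra ℚ R] {g : ℕ} (p : Fin g → R) :
    MvPolynomial (Fin g) ℚ →ₐ[ℚ] Polynomial R :=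
  aeval (fun i => Polynomial.C (p i) * Polynomial.X ^ ((i : ℕ) + 1))

/-- The total class `1 + ∑ p_i T^i`. -/
noncomputable def Q {R : Type*} [CommRing R] {g : ℕ} (p : Fin g → R) : Polynomial R :=
  1 + ∑ i : Fin g, Polynomial.C (p i) * Polynomial.X ^ ((i : ℕ) + 1)

section
variable {R : Type*} [CommRing R] [Algebra ℚ R] {g : ℕ} (p : Fin g → R)

lemma phi_monomial (s : Fin g →₀ ℕ) (c : ℚ) :
    phi p (monomial s c) = Polynomial.C (aeval p (monomial s c)) *
      Polynomial.X ^ (Finsupp.weight (fun i : Fin g => (i : ℕ) + 1) s) := by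
  rw [phi, aeval_monomial, aeval_monomial]
  rw [Finsupp.prod_fintype _ _ (by simp), Finsupp.prod_fintype _ _ (by simp)]
  simp only [mul_pow, Finset.prod_mul_distrib,
    ← pow_mul, Finset.prod_pow_eq_pow_sum, map_mul, map_prod, map_pow]
  rw [mul_assoc]
  congr 2
  congr 1
  rw [Finsupp.weight_apply, Finsupp.sum_fintype _ _ (by simp)]
  exact Finset.sum_congr rfl fun i _ => by rw [smul_eq_mul, mul_comm]

lemma phi_whc (n : ℕ) (f : MvPolynomial (Fin g) ℚ) :
    phi p (weightedHomogeneousComponent (fun i : Fin g => (i : ℕ) + 1) n f) =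
      Polynomial.C ((phi p f).coeff n) * Polynomial.X ^ n := by
  induction f using MvPolynomial.induction_on' with
  | add a b ha hb => simp only [map_add, Polynomial.coeff_add, ha, hb, add_mul]
  | monomial s c =>
    have hs := isWeightedHomogeneous_monomial (fun i : Fin g => (i : ℕ) + 1) s c rfl
    by_cases h : Finsupp.weight (fun i : Fin g => (i : ℕ) + 1) s = n
    · subst h
      rw [weightedHomogeneousComponent_of_mem hs, if_pos rfl, phi_monomial,
        Polynomial.coeff_C_mul, Polynomial.coeff_X_pow_self, mul_one]
    · rw [weightedHomogeneousComponent_of_mem hs, if_neg (Ne.symm h), phi_monomial,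
        Polynomial.coeff_C_mul, Polynomial.coeff_X_pow, if_neg (Ne.symm h), mul_zero, map_zero,
        map_zero, zero_mul]

lemma eval_one_phi (f : MvPolynomial (Fin g) ℚ) : (phi p f).eval 1 = aeval p f := by
  induction f using MvPolynomial.induction_on' with
  | add a b ha hb => simp only [map_add, Polynomial.eval_add, ha, hb]
  | monomial s c => rw [phi_monomial, Polynomial.eval_mul, Polynomial.eval_C, Polynomial.eval_pow,
      Polynomial.eval_X, one_pow, mul_one]

lemma aeval_whc (n : ℕ) (f : MvPolynomial (Fin g) ℚ) :
    aeval p (weightedHomogeneousComponent (fun i : Fin g => (i : ℕ) + 1) n f) =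
      (phi p f).coeff n := by
  rw [← eval_one_phi, phi_whc]; simp

lemma phi_Pg : phi p (Pg g) = Q p * (Q p).comp (-Polynomial.X) - 1 := by
  have h : (Q p).comp (-Polynomial.X) = 1 + ∑ i : Fin g,
      (-1) ^ ((i : ℕ) + 1) * (Polynomial.C (p i) * Polynomial.X ^ ((i : ℕ) + 1)) := by
    simp only [Q, Polynomial.add_comp, Polynomial.one_comp, Polynomial.sum_comp,
      Polynomial.mul_comp, Polynomial.C_comp, Polynomial.pow_comp, Polynomial.X_comp]
    congr 1
    refine Finset.sum_congr rfl fun i _ => ?_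
    rw [neg_pow]; ring
  rw [h]
  simp [Pg, phi, Q]

lemma coeff_comp_neg (q : Polynomial R) (n : ℕ) :
    (q.comp (-Polynomial.X)).coeff n = (-1) ^ n * q.coeff n := by
  have : (-Polynomial.X : Polynomial R) = Polynomial.C (-1) * Polynomial.X := by simp
  rw [this, Polynomial.comp_C_mul_X_coeff, mul_comm]

lemma coeff_zero_Q : (Q p).coeff 0 = 1 := by
  simp [Q, Polynomial.finsetSum_coeff, Polynomial.coeff_X_pow]

lemma coeff_succ_Q (i : Fin g) : (Q p).coeff (i + 1) = p i := by
  simp only [Q, Polynomial.coeff_add, Polynomial.finsetSum_coeff, Polynomial.coeff_C_mul,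
    Polynomial.coeff_X_pow, Polynomial.coeff_one]
  rw [Finset.sum_eq_single i]
  · simp
  · intro b _ hb
    rw [if_neg, mul_zero]
    intro h
    exact hb (Fin.ext (by omega))
  · simp

lemma coeff_big_Q (n : ℕ) (hn : g < n) : (Q p).coeff n = 0 := by
  simp only [Q, Polynomial.coeff_add, Polynomial.finsetSum_coeff, Polynomial.coeff_C_mul,
    Polynomial.coeff_X_pow, Polynomial.coeff_one]
  rw [if_neg (by omega), zero_add]
  refine Finset.sum_eq_zero fun i _ => ?_
  rw [if_neg (by omega), mul_zero]

end

lemma neg_one_pow_mul_self {R : Type*} [CommRing R] (k : ℕ) :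
    ((-1) ^ k * (-1) ^ k : R) = 1 := by
  rw [← mul_pow]; simp

/-! ### Upper bound -/

section upper
variable (g : ℕ)

/-- The class of `u_{i+1}` in the quotient. -/
noncomputable def pt (i : Fin g) : MvPolynomial (Fin g) ℚ ⧸ tautIdeal g :=
  Ideal.Quotient.mk _ (X i)

/-- The class of `u_n` in the quotient. -/
noncomputable def U (n : ℕ) : MvPolynomial (Fin g) ℚ ⧸ tautIdeal g := (Q (pt g)).coeff n

lemma aeval_pt (f : MvPolynomial (Fin g) ℚ) :
    aeval (pt g) f = Ideal.Quotient.mk (tautIdeal g) f := by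
  have : aeval (pt g) = Ideal.Quotient.mkₐ ℚ (tautIdeal g) := by
    ext i; simp [pt]
  rw [this]; rfl

lemma rel (k : ℕ) (hk : k ≠ 0) :
    ∑ x ∈ Finset.HasAntidiagonal.antidiagonal (2 * k), (-1) ^ x.2 * (U g x.1 * U g x.2) = 0 := by
  have h := aeval_whc (pt g) (2 * k) (Pg g)
  have hmem : weightedHomogeneousComponent (fun i : Fin g => (i : ℕ) + 1) (2 * k) (Pg g) ∈
      tautIdeal g := Ideal.subset_span ⟨2 * k, rfl⟩
  rw [aeval_pt, Ideal.Quotient.eq_zero_iff_mem.2 hmem, phi_Pg,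
    Polynomial.coeff_sub, Polynomial.coeff_mul, Polynomial.coeff_one,
    if_neg (by omega), sub_zero] at h
  rw [h]
  refine Finset.sum_congr rfl fun x _ => ?_
  rw [coeff_comp_neg, U, U]; ring

lemma sq_le (m : Multiset ℕ) : (m.map (· ^ 2)).sum ≤ m.sum ^ 2 := by
  induction m using Multiset.induction with
  | empty => simp
  | cons a m ih =>
    simp only [Multiset.map_cons, Multiset.sum_cons]
    nlinarith [Nat.zero_le (a * m.sum)]

/-- Span of square-free monomials. -/
noncomputable def W : Submodule ℚ (MvPolynomial (Fin g) ℚ ⧸ tautIdeal g) := by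
  classical
  exact Submodule.span ℚ
    (((Finset.Icc 1 g).powerset.image fun s => ∏ i ∈ s, U g i : Finset _) : Set _)

lemma mem_W (N : ℕ) : ∀ m : Multiset ℕ, m.sum ^ 2 - (m.map (· ^ 2)).sum ≤ N →
    (m.map (U g)).prod ∈ W g := by
  classical
  induction N using Nat.strong_induction_on with
  | _ N ih =>
  intro m hm
  by_cases hk : ∃ k ≠ 0, 2 ≤ m.count k
  · obtain ⟨k, hk0, hk⟩ := hk
    obtain ⟨m', rfl⟩ := Multiset.le_iff_exists_add.1 (Multiset.le_count_iff_replicate_le.1 hk)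
    have hr := rel g k hk0
    rw [← Finset.add_sum_erase _ _ (show (k, k) ∈ Finset.HasAntidiagonal.antidiagonal (2 * k) by
      simp; ring)] at hr
    have h2 : U g k * U g k = ∑ x ∈ (Finset.HasAntidiagonal.antidiagonal (2 * k)).erase (k, k),
        ((-1 : ℚ) ^ (x.2 + k + 1)) • (U g x.1 * U g x.2) := by
      have h3 := eq_neg_of_add_eq_zero_left hr
      have h4 : ((-1) ^ k * (-1) ^ k : MvPolynomial (Fin g) ℚ ⧸ tautIdeal g) = 1 := by
        exact neg_one_pow_mul_self k
      calc U g k * U g k = (-1) ^ k * ((-1) ^ k * (U g k * U g k)) := by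
            rw [← mul_assoc, h4, one_mul]
        _ = _ := by
          simp only at h3
          rw [h3, ← Finset.sum_neg_distrib, Finset.mul_sum]
          refine Finset.sum_congr rfl fun x _ => ?_
          refine Eq.trans ?_ (Algebra.smul_def ((-1 : ℚ) ^ (x.2 + k + 1)) (U g x.1 * U g x.2)).symm
          simp only [map_pow, map_neg, map_one]
          ring
    rw [Multiset.map_add, Multiset.prod_add, Multiset.map_replicate, Multiset.prod_replicate,
      pow_two, h2, Finset.sum_mul]
    refine Submodule.sum_mem _ fun x hx => ?_
    rw [smul_mul_assoc]
    refine Submodule.smul_mem _ _ ?_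
    obtain ⟨a, b⟩ := x
    simp only [Finset.mem_erase, Finset.HasAntidiagonal.mem_antidiagonal, ne_eq, Prod.mk.injEq] at hx
    have hb := sq_le (a ::ₘ b ::ₘ m')
    have hlt : k ^ 2 + k ^ 2 < a ^ 2 + b ^ 2 := by
      have hab : a ≠ b := by rintro rfl; exact hx.1 ⟨by omega, by omega⟩
      zify at *
      have h5 : (0 : ℤ) < ((a : ℤ) - b) ^ 2 := by
        have : (a : ℤ) - b ≠ 0 := sub_ne_zero.2 hab
        positivity
      nlinarith [hx.2]
    have hsum : (a ::ₘ b ::ₘ m').sum = (Multiset.replicate 2 k + m').sum := by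
      simp; omega
    have hsq : ((a ::ₘ b ::ₘ m').map (· ^ 2)).sum =
      a ^ 2 + b ^ 2 + (m'.map (· ^ 2)).sum := by simp [add_assoc]
    have hsq' : ((Multiset.replicate 2 k + m').map (· ^ 2)).sum =
      k ^ 2 + k ^ 2 + (m'.map (· ^ 2)).sum := by simp; ring
    have := ih ((a ::ₘ b ::ₘ m').sum ^ 2 - ((a ::ₘ b ::ₘ m').map (· ^ 2)).sum)
      (by rw [hsum] at hb ⊢; omega) (a ::ₘ b ::ₘ m') le_rfl
    simpa [mul_assoc] using this
  · push Not at hk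
    by_cases hbig : ∃ k ∈ m, g < k
    · obtain ⟨k, hkm, hkg⟩ := hbig
      have : (m.map (U g)).prod = 0 :=
        Multiset.prod_eq_zero (Multiset.mem_map.2 ⟨k, hkm, coeff_big_Q _ _ hkg⟩)
      rw [this]; exact Submodule.zero_mem _
    · push Not at hbig
      have h0 : (m.map (U g)).prod = ((m.filter (· ≠ 0)).map (U g)).prod := by
        conv_lhs => rw [← Multiset.filter_add_not (fun x => x ≠ 0) m]
        rw [Multiset.map_add, Multiset.prod_add]
        convert mul_one _
        refine Multiset.prod_eq_one fun y hy => ?_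
        obtain ⟨a, ha, rfl⟩ := Multiset.mem_map.1 hy
        have : a = 0 := by simpa using (Multiset.mem_filter.1 ha).2
        rw [this]; exact coeff_zero_Q _
      have hnd : (m.filter (· ≠ 0)).Nodup := by
        rw [Multiset.nodup_iff_count_le_one]
        intro a
        by_cases ha : a = 0
        · simp [Multiset.count_filter, ha]
        · have := hk a ha
          rw [Multiset.count_filter]
          split_ifs <;> omega
      rw [h0]
      refine Submodule.subset_span ?_
      rw [Finset.mem_coe, Finset.mem_image]
      refine ⟨⟨_, hnd⟩, ?_, rfl⟩
      rw [Finset.mem_powerset]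
      intro a ha
      have ha' : a ∈ m.filter (· ≠ 0) := ha
      rw [Multiset.mem_filter] at ha'
      have := hbig a ha'.1
      simp only [Finset.mem_Icc]
      omega

lemma mul_mem_W (f : MvPolynomial (Fin g) ℚ) : ∀ m : Multiset ℕ,
    Ideal.Quotient.mk (tautIdeal g) f * (m.map (U g)).prod ∈ W g := by
  induction f using MvPolynomial.induction_on with
  | C a =>
    intro m
    have : Ideal.Quotient.mk (tautIdeal g) (C a) * (m.map (U g)).prod =
      a • (m.map (U g)).prod := by
      exact (Algebra.smul_def a (m.map (U g)).prod).symm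
    rw [this]
    exact Submodule.smul_mem _ _ (mem_W g _ m le_rfl)
  | add a b ha hb =>
    intro m
    rw [map_add, add_mul]
    exact Submodule.add_mem _ (ha m) (hb m)
  | mul_X f i hf =>
    intro m
    have := hf (((i : ℕ) + 1) ::ₘ m)
    rw [Multiset.map_cons, Multiset.prod_cons, U, coeff_succ_Q, pt] at this
    rwa [map_mul, mul_assoc]

lemma W_top : W g = ⊤ := by
  rw [eq_top_iff]
  intro x _
  obtain ⟨f, rfl⟩ := Ideal.Quotient.mk_surjective x
  simpa using mul_mem_W g f 0

lemma upper : FiniteDimensional ℚ (MvPolynomial (Fin g) ℚ ⧸ tautIdeal g) ∧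
      Module.finrank ℚ (MvPolynomial (Fin g) ℚ ⧸ tautIdeal g) ≤ 2 ^ g := by
  classical
  have h := W_top g
  constructor
  · exact ⟨⟨_, h⟩⟩
  · rw [← finrank_top ℚ, ← h]
    refine (finrank_span_finset_le_card _).trans (Finset.card_image_le.trans ?_)
    simp

end upper

/-! ### Lower bound -/

section lower
variable (g : ℕ)

/-- signed roots -/
def rt (e : Fin g → Bool) (j : Fin g) : ℚ := if e j then ((j : ℕ) : ℚ) + 1 else -(((j : ℕ) : ℚ) + 1)

/-- the product `∏ (1 + b_j T)` -/
noncomputable def E (e : Fin g → Bool) : Polynomial ℚ :=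
  ∏ j, (1 + Polynomial.C (rt g e j) * Polynomial.X)

/-- the points -/
noncomputable def pp (e : Fin g → Bool) (i : Fin g) : ℚ := (E g e).coeff (i + 1)

lemma rt_sq (e : Fin g → Bool) (j : Fin g) : rt g e j ^ 2 = (((j : ℕ) : ℚ) + 1) ^ 2 := by
  unfold rt; split_ifs <;> ring

lemma Q_pp (e : Fin g → Bool) : Q (pp g e) = E g e := by
  ext n
  rcases n with _ | n
  · rw [coeff_zero_Q, Polynomial.coeff_zero_eq_eval_zero, E, Polynomial.eval_prod]
    simp
  · by_cases h : n < g
    · exact coeff_succ_Q (pp g e) ⟨n, h⟩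
    · rw [coeff_big_Q _ _ (by omega), Polynomial.coeff_eq_zero_of_natDegree_lt]
      have : (E g e).natDegree ≤ ∑ j : Fin g, 1 := by
        refine (Polynomial.natDegree_prod_le _ _).trans (Finset.sum_le_sum fun j _ => ?_)
        compute_degree
      simp at this
      omega

lemma phi_Pg_pp (e : Fin g → Bool) : phi (pp g e) (Pg g) =
    ∏ j : Fin g, (1 - Polynomial.C ((((j : ℕ) : ℚ) + 1) ^ 2) * Polynomial.X ^ 2) - 1 := by
  rw [phi_Pg, Q_pp, E, Polynomial.prod_comp, ← Finset.prod_mul_distrib]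
  congr 1
  refine Finset.prod_congr rfl fun j _ => ?_
  rw [← rt_sq g e]
  simp
  ring

lemma pp_inj : Function.Injective (pp g) := by
  intro e e' h
  have hE : E g e = E g e' := by rw [← Q_pp, ← Q_pp, h]
  funext j
  have hr : rt g e j ≠ 0 := by
    have := rt_sq g e j
    intro h0
    rw [h0] at this
    have h1 : (0 : ℚ) < (((j : ℕ) : ℚ) + 1) ^ 2 := by positivity
    rw [← this] at h1
    simp at h1
  have h1 : (E g e).eval (-(rt g e j)⁻¹) = 0 := by
    rw [E, Polynomial.eval_prod]
    refine Finset.prod_eq_zero (Finset.mem_univ j) ?_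
    simp [hr]
  rw [hE, E, Polynomial.eval_prod, Finset.prod_eq_zero_iff] at h1
  obtain ⟨i, -, hi⟩ := h1
  have h2 : rt g e' i = rt g e j := by
    simp at hi
    field_simp at hi
    linarith
  have h3 : (((i : ℕ) : ℚ) + 1) ^ 2 = (((j : ℕ) : ℚ) + 1) ^ 2 := by
    rw [← rt_sq g e', ← rt_sq g e, h2]
  have h4 : i = j := by
    rw [sq_eq_sq₀ (by positivity) (by positivity)] at h3
    exact Fin.ext (by exact_mod_cast add_right_cancel h3)
  subst h4
  have hp : (0 : ℚ) < ((i : ℕ) : ℚ) + 1 := by positivity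
  unfold rt at h2
  cases h5 : e i <;> cases h6 : e' i <;> simp [h5, h6] at h2 ⊢ <;> linarith

/-- Evaluation at all points. -/
noncomputable def ev : MvPolynomial (Fin g) ℚ →ₗ[ℚ] ((Fin g → Bool) → ℚ) :=
  LinearMap.pi fun e => (aeval (pp g e)).toLinearMap

/-- The `n`-th coefficient of the graded evaluation at all points. -/
noncomputable def evn (n : ℕ) : MvPolynomial (Fin g) ℚ →ₗ[ℚ] ((Fin g → Bool) → ℚ) :=
  LinearMap.pi fun e => (Polynomial.lcoeff ℚ n).comp (phi (pp g e)).toLinearMap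

lemma ev_apply (f e) : ev g f e = aeval (pp g e) f := rfl
lemma evn_apply (n f e) : evn g n f e = (phi (pp g e) f).coeff n := rfl

lemma ev_surj : Function.Surjective (ev g) := by
  classical
  intro y
  have key : ∀ e, ∃ F : MvPolynomial (Fin g) ℚ, ev g F = Pi.single e 1 := by
    intro e
    have hne : ∀ e', ∃ G : MvPolynomial (Fin g) ℚ,
        e' ≠ e → aeval (pp g e) G = (1 : ℚ) ∧ aeval (pp g e') G = (0 : ℚ) := by
      intro e'
      by_cases h : e' = e
      · exact ⟨0, fun h' => absurd h h'⟩
      · obtain ⟨i, hi⟩ := Function.ne_iff.1 (fun h' => h (pp_inj g h'))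
        have hi' : pp g e i - pp g e' i ≠ 0 := sub_ne_zero.2 hi.symm
        refine ⟨C (pp g e i - pp g e' i)⁻¹ * (X i - C (pp g e' i)), fun _ => ⟨?_, ?_⟩⟩
        · simp [hi']
        · simp
    choose G hG using hne
    refine ⟨∏ e' ∈ Finset.univ.erase e, G e', ?_⟩
    funext e'
    rw [ev_apply, map_prod]
    by_cases h : e' = e
    · subst h
      rw [Pi.single_eq_same]
      exact Finset.prod_eq_one fun x hx => (hG x (Finset.ne_of_mem_erase hx)).1
    · rw [Pi.single_eq_of_ne h]
      exact Finset.prod_eq_zero (Finset.mem_erase.2 ⟨h, Finset.mem_univ _⟩) (hG e' h).2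
  choose F hF using key
  refine ⟨∑ e, y e • F e, ?_⟩
  simp only [map_sum, map_smul, hF]
  funext e
  simp [Finset.sum_apply, Pi.single_apply]

lemma evn_mem (B : Set (Fin g →₀ ℕ))
    (hB : ∀ f : MvPolynomial (Fin g) ℚ, ∃ v ∈ Submodule.span ℚ ((fun s => monomial s (1 : ℚ)) '' B),
      f - v ∈ tautIdeal g) (n : ℕ) : ∀ f, evn g n f ∈
        Submodule.span ℚ ((fun s => ev g (monomial s (1 : ℚ))) '' B) := by
  induction n using Nat.strong_induction_on with
  | _ n ih =>
  intro f
  obtain ⟨v, hv, hf⟩ := hB f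
  have h1 : evn g n v ∈ Submodule.span ℚ ((fun s => ev g (monomial s (1 : ℚ))) '' B) := by
    refine Submodule.span_induction ?_ ?_ ?_ ?_ hv
    · rintro _ ⟨s, hs, rfl⟩
      by_cases h : Finsupp.weight (fun i : Fin g => (i : ℕ) + 1) s = n
      · have : evn g n (monomial s 1) = ev g (monomial s 1) := by
          funext e
          rw [evn_apply, phi_monomial, h, ev_apply]
          simp
        simp only [this]
        exact Submodule.subset_span ⟨s, hs, rfl⟩
      · have : evn g n (monomial s 1) = 0 := by
          funext e
          rw [evn_apply, phi_monomial]
          simp [Polynomial.coeff_X_pow, Ne.symm h]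
        simp only [this]
        exact Submodule.zero_mem _
    · simp
    · intro x y _ _ hx hy
      rw [map_add]; exact Submodule.add_mem _ hx hy
    · intro a x _ hx
      rw [map_smul]; exact Submodule.smul_mem _ _ hx
  have h2 : ∀ a, evn g n (a * (f - v)) ∈
      Submodule.span ℚ ((fun s => ev g (monomial s (1 : ℚ))) '' B) := by
    refine Submodule.span_induction (p := fun x _ => ∀ a, evn g n (a * x) ∈
      Submodule.span ℚ ((fun s => ev g (monomial s (1 : ℚ))) '' B)) ?_ ?_ ?_ ?_ hf
    · rintro _ ⟨m, rfl⟩ a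
      set c : ℚ := (∏ j : Fin g, (1 - Polynomial.C ((((j : ℕ) : ℚ) + 1) ^ 2) *
        Polynomial.X ^ 2) - 1 : Polynomial ℚ).coeff m with hc
      have hphi : ∀ e, phi (pp g e) (a * weightedHomogeneousComponent
          (fun i : Fin g => (i : ℕ) + 1) m (Pg g)) =
          Polynomial.C c * phi (pp g e) a * Polynomial.X ^ m := by
        intro e
        rw [map_mul, phi_whc, phi_Pg_pp, ← hc]; ring
      by_cases hm : m ≤ n ∧ m ≠ 0
      · have : evn g n (a * weightedHomogeneousComponent
          (fun i : Fin g => (i : ℕ) + 1) m (Pg g)) = c • evn g (n - m) a := by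
          funext e
          rw [evn_apply, hphi, Polynomial.coeff_mul_X_pow', if_pos hm.1, Polynomial.coeff_C_mul]
          rfl
        simp only [this]
        exact Submodule.smul_mem _ _ (ih _ (by omega) a)
      · have : evn g n (a * weightedHomogeneousComponent
          (fun i : Fin g => (i : ℕ) + 1) m (Pg g)) = 0 := by
          funext e
          rw [evn_apply, hphi, Polynomial.coeff_mul_X_pow']
          split_ifs with hmn
          · have hm0 : m = 0 := by
              by_contra h; exact hm ⟨hmn, h⟩
            have : c = 0 := by
              rw [hc, hm0, Polynomial.coeff_zero_eq_eval_zero]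
              simp [Polynomial.eval_prod]
            simp [this]
          · rfl
        simp only [this]
        exact Submodule.zero_mem _
    · simp
    · intro x y _ _ hx hy a
      rw [mul_add, map_add]; exact Submodule.add_mem _ (hx a) (hy a)
    · intro b x _ hx a
      rw [smul_eq_mul, ← mul_assoc]; exact hx _
  have := Submodule.add_mem _ (h2 1) h1
  rwa [← map_add, one_mul, sub_add_cancel] at this

lemma ev_mem (f : MvPolynomial (Fin g) ℚ) (S : Submodule ℚ ((Fin g → Bool) → ℚ))
    (h : ∀ n, evn g n f ∈ S) : ev g f ∈ S := by
  have : ev g f = ∑ n ∈ Finset.range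
      ((Finset.univ.sup fun e => (phi (pp g e) f).natDegree) + 1), evn g n f := by
    funext e
    rw [Finset.sum_apply, ev_apply, ← eval_one_phi, Polynomial.eval_eq_sum_range'
      (n := (Finset.univ.sup fun e => (phi (pp g e) f).natDegree) + 1)]
    · simp [evn_apply]
    · exact Nat.lt_succ_of_le (Finset.le_sup (f := fun e => (phi (pp g e) f).natDegree)
        (Finset.mem_univ e))
  rw [this]
  exact Submodule.sum_mem _ fun n _ => h n

lemma lower : 2 ^ g ≤ Module.finrank ℚ (MvPolynomial (Fin g) ℚ ⧸ tautIdeal g) := by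
  classical
  haveI := (upper g).1
  let π := (Ideal.Quotient.mkₐ ℚ (tautIdeal g)).toLinearMap
  obtain ⟨b, hb, hspan, hli⟩ := exists_linearIndependent ℚ
    (Set.range fun s : Fin g →₀ ℕ => π (monomial s (1 : ℚ)))
  have hfin : b.Finite := hli.setFinite
  obtain ⟨B, hBinj, hB⟩ : ∃ B : Set (Fin g →₀ ℕ),
      Set.InjOn (fun s : Fin g →₀ ℕ => π (monomial s (1 : ℚ))) B ∧
        (fun s : Fin g →₀ ℕ => π (monomial s (1 : ℚ))) '' B = b := by
    obtain ⟨B, -, h⟩ := Set.SurjOn.exists_bijOn_subset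
      (f := fun s : Fin g →₀ ℕ => π (monomial s (1 : ℚ))) (s := Set.univ) (t := b)
      (by rw [Set.SurjOn, Set.image_univ]; exact hb)
    exact ⟨B, h.injOn, h.image_eq⟩
  have hBfin : B.Finite := Set.Finite.of_finite_image (hB ▸ hfin) hBinj
  have htop : Submodule.map π (Submodule.span ℚ ((fun s => monomial s (1 : ℚ)) '' B)) = ⊤ := by
    rw [Submodule.map_span, ← Set.image_comp]
    have : (π ∘ fun s : Fin g →₀ ℕ => monomial s (1 : ℚ)) '' B = b := hB
    rw [this, hspan]
    have h2 : (Set.range fun s : Fin g →₀ ℕ => π (monomial s (1 : ℚ))) =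
      π '' (Set.range fun s : Fin g →₀ ℕ => monomial s (1 : ℚ)) := by
      rw [← Set.range_comp]; rfl
    have h3 : Submodule.span ℚ (Set.range fun s : Fin g →₀ ℕ => monomial s (1 : ℚ)) = ⊤ := by
      have := (MvPolynomial.basisMonomials (Fin g) ℚ).span_eq
      rwa [MvPolynomial.coe_basisMonomials] at this
    rw [h2, ← Submodule.map_span, h3, Submodule.map_top, LinearMap.range_eq_top]
    exact Ideal.Quotient.mk_surjective
  have hrep : ∀ f : MvPolynomial (Fin g) ℚ,
      ∃ v ∈ Submodule.span ℚ ((fun s => monomial s (1 : ℚ)) '' B), f - v ∈ tautIdeal g := by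
    intro f
    have : π f ∈ Submodule.map π (Submodule.span ℚ ((fun s => monomial s (1 : ℚ)) '' B)) := by
      rw [htop]; trivial
    obtain ⟨v, hv, hvf⟩ := this
    exact ⟨v, hv, Ideal.Quotient.eq.1 hvf.symm⟩
  have hT : Submodule.span ℚ ((fun s => ev g (monomial s (1 : ℚ))) '' B) = ⊤ := by
    rw [eq_top_iff]
    intro y _
    obtain ⟨f, rfl⟩ := ev_surj g y
    exact ev_mem g f _ fun n => evn_mem g B hrep n f
  have hcard : B.ncard ≤ Module.finrank ℚ (MvPolynomial (Fin g) ℚ ⧸ tautIdeal g) := by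
    rw [← Set.ncard_image_of_injOn hBinj, hB]
    haveI := hfin.fintype
    rw [← Nat.card_coe_set_eq, Nat.card_eq_fintype_card]
    exact hli.fintype_card_le_finrank
  refine le_trans ?_ hcard
  have h5 : Module.finrank ℚ ((Fin g → Bool) → ℚ) = 2 ^ g := by simp
  rw [← h5, ← finrank_top ℚ, ← hT]
  haveI := hBfin.fintype
  haveI := (hBfin.image (fun s => ev g (monomial s (1 : ℚ)))).fintype
  refine (finrank_span_le_card (R := ℚ) _).trans ?_
  rw [← Set.ncard_eq_toFinset_card']
  exact Set.ncard_image_le hBfin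

end lower

end TautAux

theorem dim_tautRing (g : ℕ) (hg : 1 ≤ g) :
    FiniteDimensional ℚ (MvPolynomial (Fin g) ℚ ⧸ tautIdeal g) ∧
      Module.finrank ℚ (MvPolynomial (Fin g) ℚ ⧸ tautIdeal g) = 2 ^ g :=
  ⟨(TautAux.upper g).1, le_antisymm (TautAux.upper g).2 (TautAux.lower g)⟩
end

section
/- Let k be a perfect field of characteristic p > 0, (H, ω) a finite-dimensional symplectic k-vector space, and I ⊆ H an isotropic subspace, with H' = I^⊥/I the induced symplectic space. Then for every symplectic zip ψ on (H', ω') there exists a symplectic zip φ on (H, ω) compatible with I whose induced map φ' on H' equals ψ; i.e. the reduction map φ ↦ φ' from zips on H compatible with I to zips on H' is surjective. -/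
/-- The orthogonal complement `F^⊥ = {x ∈ H : ω x y = 0 for all y ∈ F}`. -/
def perp {k H : Type*} [Field k] [AddCommGroup H] [Module k H]
    (ω : H →ₗ[k] H →ₗ[k] k) (F : Submodule k H) : Submodule k H where
  carrier := {x | ∀ y ∈ F, ω x y = 0}
  add_mem' := by
    intro a b ha hb y hy
    simp only [map_add, LinearMap.add_apply, ha y hy, hb y hy, add_zero]
  zero_mem' := by
    intro y hy
    simp
  smul_mem' := by
    intro c x hx y hy
    simp only [map_smul, LinearMap.smul_apply, hx y hy, smul_zero]

/-- A subspace is Lagrangian if it equals its own orthogonal complement. -/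
def IsLagrangian {k H : Type*} [Field k] [AddCommGroup H] [Module k H]
    (ω : H →ₗ[k] H →ₗ[k] k) (F : Submodule k H) : Prop :=
  perp ω F = F

/-- Over a perfect field the Frobenius is surjective, so ranges of Frobenius-semilinear
maps are submodules. -/
instance frobeniusSurjective (k : Type*) [Field k] (p : ℕ) [Fact p.Prime] [CharP k p]
    [PerfectRing k p] : RingHomSurjective (frobenius k p) :=
  ⟨surjective_frobenius k p⟩

theorem zr_frob {k : Type*} [Field k] (p : ℕ) [Fact p.Prime] [CharP k p] [PerfectRing k p]
    (J : Type*) [AddCommGroup J] [Module k J] [FiniteDimensional k J] :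
    ∃ F : J →ₛₗ[frobenius k p] J, Function.Injective F ∧ Function.Surjective F := by
  let b := Module.finBasis k J
  refine ⟨{ toFun := fun v => b.equivFun.symm (fun i => frobenius k p (b.equivFun v i))
            map_add' := ?_
            map_smul' := ?_ }, ?_, ?_⟩
  · intro x y
    rw [← map_add]
    congr 1
    funext i
    simp only [map_add, Pi.add_apply]
  · intro a x
    rw [← map_smul]
    congr 1
    funext i
    simp only [map_smul, Pi.smul_apply, smul_eq_mul, map_mul]
  · intro x y h
    have h1 := b.equivFun.symm.injective h
    apply b.equivFun.injective
    funext i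
    exact (frobenius_inj k p) (congrFun h1 i)
  · intro y
    choose c hc using fun i => surjective_frobenius k p (b.equivFun y i)
    refine ⟨b.equivFun.symm c, ?_⟩
    apply b.equivFun.injective
    funext i
    simp only [LinearMap.coe_mk, AddHom.coe_mk, LinearEquiv.apply_symm_apply, hc]

section
variable {k H : Type*} [Field k] [AddCommGroup H] [Module k H] (ω : H →ₗ[k] H →ₗ[k] k)

theorem zr_mem {F : Submodule k H} {x : H} : x ∈ perp ω F ↔ ∀ y ∈ F, ω x y = 0 := Iff.rfl

theorem zr_neg (halt : ∀ x, ω x x = 0) (x y : H) : ω x y = - ω y x := by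
  have h := halt (x + y)
  simp only [map_add, LinearMap.add_apply, halt, zero_add, add_zero] at h
  exact eq_neg_of_add_eq_zero_right h

theorem zr_swap (halt : ∀ x, ω x x = 0) {x y : H} (h : ω x y = 0) : ω y x = 0 := by
  rw [zr_neg ω halt, h, neg_zero]

theorem zr_anti {A B : Submodule k H} (h : A ≤ B) : perp ω B ≤ perp ω A :=
  fun _ hx y hy => hx y (h hy)

theorem zr_perp_perp [FiniteDimensional k H] (halt : ∀ x, ω x x = 0)
    (hnd : ∀ x, (∀ y, ω x y = 0) → x = 0) (F : Submodule k H) : perp ω (perp ω F) = F := by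
  have hr : LinearMap.BilinForm.IsRefl ω := fun x y h => zr_swap ω halt h
  have e : ∀ G : Submodule k H, perp ω G = LinearMap.BilinForm.orthogonal ω G := by
    intro G
    ext x
    rw [zr_mem, LinearMap.BilinForm.mem_orthogonal_iff]
    exact ⟨fun h y hy => zr_swap ω halt (h y hy), fun h y hy => zr_swap ω halt (h y hy)⟩
  have hn : LinearMap.BilinForm.Nondegenerate ω :=
    ⟨hnd, fun y h => hnd y (fun x => zr_swap ω halt (h x))⟩
  rw [e, e]
  exact LinearMap.BilinForm.orthogonal_orthogonal hn hr F

theorem zr_sup (A B : Submodule k H) : perp ω (A ⊔ B) = perp ω A ⊓ perp ω B := by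
  apply le_antisymm
  · exact le_inf (zr_anti ω le_sup_left) (zr_anti ω le_sup_right)
  · rintro x ⟨h1, h2⟩ y hy
    obtain ⟨a, ha, b, hb, rfl⟩ := Submodule.mem_sup.1 hy
    rw [map_add, h1 a ha, h2 b hb, add_zero]

theorem zr_inf [FiniteDimensional k H] (halt : ∀ x, ω x x = 0)
    (hnd : ∀ x, (∀ y, ω x y = 0) → x = 0) (A B : Submodule k H) :
    perp ω (A ⊓ B) = perp ω A ⊔ perp ω B := by
  rw [← zr_perp_perp ω halt hnd (perp ω A ⊔ perp ω B), zr_sup,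
    zr_perp_perp ω halt hnd, zr_perp_perp ω halt hnd]

theorem zr_compl [FiniteDimensional k H] (halt : ∀ x, ω x x = 0)
    (hnd : ∀ x, (∀ y, ω x y = 0) → x = 0) (I : Submodule k H) (hiso : I ≤ perp ω I) :
    ∃ J : Submodule k H, J ≤ perp ω J ∧ IsCompl J (perp ω I) := by
  let S : Set (Submodule k H) := {J | J ≤ perp ω J ∧ Disjoint J (perp ω I)}
  have hS : S.Nonempty := ⟨⊥, bot_le, disjoint_bot_left⟩
  obtain ⟨J, ⟨hJ, hd⟩, hmax⟩ := WellFounded.has_min (wellFounded_gt (α := Submodule k H)) S hS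
  refine ⟨J, hJ, hd, ?_⟩
  have key : perp ω J ≤ J ⊔ perp ω I := by
    intro v hv
    by_contra hvn
    refine hmax (J ⊔ Submodule.span k {v}) ⟨?_, ?_⟩ ?_
    · intro x hx y hy
      obtain ⟨a, ha, b, hb, rfl⟩ := Submodule.mem_sup.1 hx
      obtain ⟨c, hc, d, hd, rfl⟩ := Submodule.mem_sup.1 hy
      obtain ⟨s, rfl⟩ := Submodule.mem_span_singleton.1 hb
      obtain ⟨t, rfl⟩ := Submodule.mem_span_singleton.1 hd
      simp [hJ ha c hc, hv c hc, zr_swap ω halt (hv a ha), halt]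
    · rw [Submodule.disjoint_def]
      intro x hx hx2
      obtain ⟨a, ha, b, hb, rfl⟩ := Submodule.mem_sup.1 hx
      obtain ⟨s, rfl⟩ := Submodule.mem_span_singleton.1 hb
      by_cases hs : s = 0
      · subst hs
        rw [zero_smul, add_zero] at hx2 ⊢
        exact Submodule.disjoint_def.1 hd a ha hx2
      · exfalso
        apply hvn
        have : s • v ∈ J ⊔ perp ω I :=
          Submodule.mem_sup.2 ⟨-a, J.neg_mem ha, a + s • v, hx2, by abel⟩
        exact (Submodule.smul_mem_iff _ hs).1 this
    · refine lt_of_le_of_ne le_sup_left ?_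
      intro h
      apply hvn
      apply Submodule.mem_sup_left
      rw [h]
      exact Submodule.mem_sup_right (Submodule.mem_span_singleton_self v)
  have h2 := zr_anti ω key
  rw [zr_sup, zr_perp_perp ω halt hnd, zr_perp_perp ω halt hnd] at h2
  have h3 : perp ω J ⊓ I = ⊥ := by
    rw [eq_bot_iff]
    exact (le_inf h2 (inf_le_right.trans hiso)).trans hd.le_bot
  rw [codisjoint_iff]
  have h4 := zr_inf ω halt hnd (perp ω J) I
  rw [h3, zr_perp_perp ω halt hnd] at h4
  rw [← h4, eq_top_iff]
  intro x _ y hy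
  rw [(Submodule.mem_bot k).1 hy, map_zero]

theorem zr_split [FiniteDimensional k H] (halt : ∀ x, ω x x = 0)
    (hnd : ∀ x, (∀ y, ω x y = 0) → x = 0) (I J : Submodule k H) (hiso : I ≤ perp ω I)
    (hd : IsCompl J (perp ω I)) : perp ω I ≤ I ⊔ perp ω (I ⊔ J) := by
  have h := zr_inf ω halt hnd (perp ω I) (I ⊔ J)
  rw [zr_perp_perp ω halt hnd] at h
  rw [← h]
  apply zr_anti
  rintro x ⟨hx, hx2⟩
  obtain ⟨a, ha, b, hb, rfl⟩ := Submodule.mem_sup.1 hx2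
  have hb2 : b ∈ perp ω I := by
    have := (perp ω I).sub_mem hx (hiso ha)
    simpa using this
  rw [Submodule.disjoint_def.1 hd.disjoint b hb hb2, add_zero]
  exact ha

end

theorem zip_reduction_surjective
    {k : Type*} [Field k] (p : ℕ) [Fact p.Prime] [CharP k p] [PerfectRing k p]
    {H : Type*} [AddCommGroup H] [Module k H] [FiniteDimensional k H]
    (ω : H →ₗ[k] H →ₗ[k] k)
    (halt : ∀ x, ω x x = 0)
    (hnd : ∀ x, (∀ y, ω x y = 0) → x = 0)
    (I : Submodule k H) (hiso : I ≤ perp ω I)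
    -- the induced form `ω'` on `H' = I^⊥ / I`:
    (ω' : (perp ω I ⧸ I.comap (perp ω I).subtype) →ₗ[k]
        (perp ω I ⧸ I.comap (perp ω I).subtype) →ₗ[k] k)
    (hω' : ∀ x y : perp ω I,
        ω' (Submodule.Quotient.mk x) (Submodule.Quotient.mk y) = ω (x : H) (y : H))
    -- a symplectic zip `ψ` on `(H', ω')`:
    (ψ : (perp ω I ⧸ I.comap (perp ω I).subtype) →
        (perp ω I ⧸ I.comap (perp ω I).subtype))
    (hψadd : ∀ z w, ψ (z + w) = ψ z + ψ w)
    (hψsmul : ∀ (a : k) z, ψ (a • z) = a ^ p • ψ z)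
    (hψker : ∃ K' : Submodule k (perp ω I ⧸ I.comap (perp ω I).subtype),
        (K' : Set (perp ω I ⧸ I.comap (perp ω I).subtype)) = {z | ψ z = 0} ∧
        IsLagrangian ω' K')
    (hψrange : ∃ R' : Submodule k (perp ω I ⧸ I.comap (perp ω I).subtype),
        (R' : Set (perp ω I ⧸ I.comap (perp ω I).subtype)) = Set.range ψ ∧
        IsLagrangian ω' R') :
    -- there is a symplectic zip `φ` on `(H, ω)`, compatible with `I`, inducing `ψ`:
    ∃ φ : H →ₛₗ[frobenius k p] H,
      IsLagrangian ω (LinearMap.ker φ) ∧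
      IsLagrangian ω (LinearMap.range φ) ∧
      (∀ x ∈ I, φ x = 0) ∧
      (∀ x ∈ perp ω I, φ x ∈ perp ω I) ∧
      (∀ x : H, φ x ∈ perp ω I → x ∈ perp ω I) ∧
      (∀ y : H, ∃ x : H, y - φ x ∈ perp ω I) ∧
      (∀ (x : perp ω I) (hx : φ (x : H) ∈ perp ω I),
        ψ (Submodule.Quotient.mk x) =
          Submodule.Quotient.mk (⟨φ (x : H), hx⟩ : perp ω I)) := by
  obtain ⟨K', hK, hKL⟩ := hψker
  obtain ⟨R', hR, hRL⟩ := hψrange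
  obtain ⟨J, hJ, hd⟩ := zr_compl ω halt hnd I hiso
  obtain ⟨F, hFi, hFs⟩ := zr_frob (k := k) p J
  have hsplit := zr_split ω halt hnd I J hiso hd
  have hψ0 : ψ 0 = 0 := by simpa using hψadd 0 0
  have hKm : ∀ z, z ∈ K' ↔ ψ z = 0 := fun z => by
    rw [← SetLike.mem_coe, hK]; rfl
  have hRm : ∀ z, z ∈ R' ↔ ∃ w, ψ w = z := fun z => by
    rw [← SetLike.mem_coe, hR]; rfl
  -- the section
  have hW : perp ω (I ⊔ J) ≤ perp ω I := zr_anti ω le_sup_left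
  have hWJ : perp ω (I ⊔ J) ≤ perp ω J := zr_anti ω le_sup_right
  obtain ⟨t, ht⟩ := LinearMap.exists_rightInverse_of_surjective
    ((I.comap (perp ω I).subtype).mkQ ∘ₗ Submodule.inclusion hW) (by
      rw [LinearMap.range_eq_top]
      intro z
      obtain ⟨x, rfl⟩ := Submodule.Quotient.mk_surjective _ z
      obtain ⟨a, ha, b, hb, hab⟩ := Submodule.mem_sup.1 (hsplit x.2)
      refine ⟨⟨b, hb⟩, ?_⟩
      refine (Submodule.Quotient.eq _).2 ?_
      have : b - (x : H) = -a := by rw [← hab]; abel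
      simp only [Submodule.mem_comap, Submodule.subtype_apply, Submodule.coe_sub,
        Submodule.coe_inclusion, this]
      exact I.neg_mem ha)
  have hsI : ∀ z, (t z : H) ∈ perp ω I := fun z => hW (t z).2
  have hsmk : ∀ z, (Submodule.Quotient.mk (⟨(t z : H), hsI z⟩ : perp ω I) :
      perp ω I ⧸ I.comap (perp ω I).subtype) = z := fun z => LinearMap.congr_fun ht z
  have hsJ : ∀ z, ∀ j ∈ J, ω (t z : H) j = 0 := fun z => hWJ (t z).2
  have hsω : ∀ z w, ω (t z : H) (t w : H) = ω' z w := fun z w => by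
    have := hω' ⟨_, hsI z⟩ ⟨_, hsI w⟩
    rw [hsmk, hsmk] at this
    exact this.symm
  have hWI : ∀ x ∈ I, x ∈ perp ω J → x = 0 := by
    intro x hx hxJ
    apply hnd
    intro y
    obtain ⟨a, ha, b, hb, rfl⟩ := Submodule.mem_sup.1
      (show y ∈ J ⊔ perp ω I by rw [hd.sup_eq_top]; trivial)
    rw [map_add, hxJ a ha, zr_swap ω halt (hb x hx), add_zero]
  let Q := J.projectionOnto (perp ω I) hd
  let P := (perp ω I).projectionOnto J hd.symm
  have hQJ : ∀ j : J, Q j = j := fun j => Submodule.projectionOnto_apply_left hd j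
  have hQI : ∀ x : perp ω I, Q x = 0 := fun j => Submodule.projectionOnto_apply_right hd j
  have hPJ : ∀ j : J, P j = 0 := fun j => Submodule.projectionOnto_apply_right hd.symm j
  have hPI : ∀ x : perp ω I, P x = x := fun j =>
    Submodule.projectionOnto_apply_left hd.symm j
  let mkI : perp ω I →ₗ[k] (perp ω I ⧸ I.comap (perp ω I).subtype) := Submodule.mkQ _
  let φ : H →ₛₗ[frobenius k p] H :=
    { toFun := fun x => (F (Q x) : H) + (t (ψ (mkI (P x))) : H)
      map_add' := by
        intro x y
        simp only [map_add, hψadd, Submodule.coe_add]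
        abel
      map_smul' := by
        intro a x
        simp only [map_smul, hψsmul, LinearMap.map_smulₛₗ, Submodule.coe_smul, smul_add,
          frobenius_def] }
  have hφ : ∀ (j : J) (x : perp ω I), φ ((j : H) + x) = (F j : H) + (t (ψ (mkI x)) : H) := by
    intro j x
    change (F (Q _) : H) + (t (ψ (mkI (P _))) : H) = _
    rw [map_add Q, map_add P, hQJ, hQI, hPJ, hPI, add_zero, zero_add]
  have hφI : ∀ (x : perp ω I), φ x = (t (ψ (mkI x)) : H) := by
    intro x
    have := hφ 0 x
    simpa using this
  have hφJ : ∀ (j : J), φ j = (F j : H) := by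
    intro j
    have := hφ j 0
    simpa [hψ0] using this
  have hdec : ∀ y : H, ∃ (j : J) (x : perp ω I), y = (j : H) + x := by
    intro y
    obtain ⟨a, ha, b, hb, rfl⟩ := Submodule.mem_sup.1
      (show y ∈ J ⊔ perp ω I by rw [hd.sup_eq_top]; trivial)
    exact ⟨⟨a, ha⟩, ⟨b, hb⟩, rfl⟩
  have hI0 : ∀ x ∈ I, φ x = 0 := by
    intro x hx
    have h0 : mkI ⟨x, hiso hx⟩ = 0 := (Submodule.Quotient.mk_eq_zero _).2 hx
    have := hφI ⟨x, hiso hx⟩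
    rw [h0, hψ0, map_zero] at this
    exact this
  have hback : ∀ x : H, φ x ∈ perp ω I → x ∈ perp ω I := by
    intro x hx
    obtain ⟨j, b, rfl⟩ := hdec x
    rw [hφ] at hx
    have h1 : (F j : H) ∈ perp ω I := by
      have := (perp ω I).sub_mem hx (hsI (ψ (mkI b)))
      simpa using this
    have h2 : F j = 0 := Subtype.ext (Submodule.disjoint_def.1 hd.disjoint _ (F j).2 h1)
    have h3 : j = 0 := hFi (h2.trans (map_zero F).symm)
    rw [h3]
    simp
  have hker : ∀ x : perp ω I, φ x = 0 ↔ mkI x ∈ K' := by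
    intro x
    rw [hφI, hKm]
    constructor
    · intro h
      have h1 : t (ψ (mkI x)) = 0 := Subtype.ext h
      have h2 := LinearMap.congr_fun ht (ψ (mkI x))
      rw [LinearMap.comp_apply, h1, map_zero] at h2
      exact h2.symm
    · intro h
      rw [h, map_zero]
      rfl
  refine ⟨φ, ?_, ?_, hI0, ?_, hback, ?_, ?_⟩
  · apply le_antisymm
    · intro y hy
      have hyI : y ∈ perp ω I := fun x hx => hy x (hI0 x hx)
      refine (hker ⟨y, hyI⟩).2 ?_
      rw [← hKL]
      intro z hz
      obtain ⟨x, rfl⟩ := Submodule.Quotient.mk_surjective _ z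
      exact (hω' _ _).trans (hy x ((hker x).2 hz))
    · intro x hx y hy
      have hxI : x ∈ perp ω I := hback x (by rw [LinearMap.mem_ker.1 hx]; exact zero_mem _)
      have hyI : y ∈ perp ω I := hback y (by rw [LinearMap.mem_ker.1 hy]; exact zero_mem _)
      have h1 : mkI ⟨x, hxI⟩ ∈ K' := (hker ⟨x, hxI⟩).1 hx
      have h2 : mkI ⟨y, hyI⟩ ∈ K' := (hker ⟨y, hyI⟩).1 hy
      rw [← hKL] at h1
      exact (hω' ⟨x, hxI⟩ ⟨y, hyI⟩).symm.trans (h1 _ h2)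
  · apply le_antisymm
    · intro y hy
      obtain ⟨j, b, rfl⟩ := hdec y
      have hbJ : (b : H) ∈ perp ω J := by
        intro i hi
        obtain ⟨i', hi'⟩ := hFs ⟨i, hi⟩
        have h1 := hy i ⟨i', by rw [hφJ, hi']⟩
        rw [map_add, LinearMap.add_apply, hJ j.2 i hi, zero_add] at h1
        exact h1
      have hb : (t (mkI b) : H) = b := by
        have h1 : (t (mkI b) : H) - b ∈ I :=
          (Submodule.Quotient.eq (I.comap (perp ω I).subtype)).1 (hsmk (mkI b))
        have h2 : (t (mkI b) : H) - b ∈ perp ω J := sub_mem (hsJ _) hbJ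
        exact sub_eq_zero.1 (hWI _ h1 h2)
      have hbR : mkI b ∈ R' := by
        rw [← hRL]
        intro z hz
        obtain ⟨w, rfl⟩ := (hRm z).1 hz
        obtain ⟨x, rfl⟩ := Submodule.Quotient.mk_surjective _ w
        have h1 := hy _ ⟨x, rfl⟩
        rw [hφI, map_add, LinearMap.add_apply, zr_swap ω halt (hsJ _ j j.2), zero_add, ← hb,
          hsω] at h1
        exact h1
      obtain ⟨w, hw⟩ := (hRm _).1 hbR
      obtain ⟨x, rfl⟩ := Submodule.Quotient.mk_surjective _ w
      obtain ⟨i, hi⟩ := hFs j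
      refine ⟨(i : H) + x, ?_⟩
      rw [hφ, hi, ← hb]
      congr 3
    · rintro _ ⟨x, rfl⟩ _ ⟨y, rfl⟩
      obtain ⟨j, b, rfl⟩ := hdec x
      obtain ⟨i, c, rfl⟩ := hdec y
      have h1 : ψ (mkI b) ∈ R' := (hRm _).2 ⟨_, rfl⟩
      have h2 : ψ (mkI c) ∈ R' := (hRm _).2 ⟨_, rfl⟩
      rw [← hRL] at h1
      rw [hφ, hφ]
      simp only [map_add, LinearMap.add_apply]
      rw [hJ (F j).2 _ (F i).2, hsJ _ _ (F i).2, zr_swap ω halt (hsJ _ _ (F j).2), hsω,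
        h1 _ h2]
      simp
  · intro x hx
    have := hφI ⟨x, hx⟩
    rw [show φ x = _ from this]
    exact hsI _
  · intro y
    obtain ⟨j, b, rfl⟩ := hdec y
    obtain ⟨i, hi⟩ := hFs j
    refine ⟨i, ?_⟩
    rw [hφJ, hi]
    simp
  · intro x hx
    rw [← hsmk (ψ (Submodule.Quotient.mk x))]
    congr 1
    exact Subtype.ext (hφI x).symm
end
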